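/- Extended Gronwall lemma with weakly singular kernel: Let α > 0, a ≥ 0, b ≥ 0 and T ≥ 0, and let u : [0,T] → ℝ be nonnegative and integrable. If for every t ∈ [0,T] one has u(t) ≤ a + b ∫₀ᵗ u(s) (t−s)^{α−1} ds, then there exists a constant K, depending only on α, b and T (and not on a or u), such that u(t) ≤ a·K for all t ∈ [0,T]. -/

import Mathlib

open MeasureTheory Set

/-- If the kernel `κ` has mass at most `1 / 2`, an integrable `g` with `g ≤ A + g ⋆ κ` satisfies
`g ≤ 2 A` everywhere. -/
theorem le_two_mul_of_le_add_lintegral_mul_kernel {g κ : ℝ → ENNReal} {A : ENNReal}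
    (hg : AEMeasurable g) (hg_fin : ∫⁻ t, g t ≠ ⊤) (hκ : Measurable κ)
    (hκ_le : ∫⁻ x, κ x ≤ 2⁻¹) (h : ∀ t, g t ≤ A + ∫⁻ s, g s * κ (t - s)) (t : ℝ) :
    g t ≤ 2 * A := by
  have two_inv : 2 * A * 2⁻¹ = A := by
    rw [mul_comm 2 A, mul_assoc, ENNReal.mul_inv_cancel (by simp) (by simp), mul_one]
  have const_le (t : ℝ) : ∫⁻ s, 2 * A * κ (t - s) ≤ A := by
    rw [lintegral_const_mul _ (by fun_prop), lintegral_sub_left_eq_self κ t]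
    calc 2 * A * ∫⁻ x, κ x ≤ 2 * A * 2⁻¹ := by gcongr
      _ = A := two_inv
  set e : ℝ → ENNReal := fun t ↦ g t - 2 * A with he
  have he_meas : AEMeasurable e := hg.sub_const _
  have he_le (t : ℝ) : e t ≤ ∫⁻ s, e s * κ (t - s) := by
    refine tsub_le_iff_left.2 ?_
    calc g t ≤ A + ∫⁻ s, g s * κ (t - s) := h t
      _ ≤ A + ∫⁻ s, (2 * A * κ (t - s) + e s * κ (t - s)) := by
        gcongr with s
        rw [← add_mul]
        gcongr
        exact le_add_tsub
      _ = A + ((∫⁻ s, 2 * A * κ (t - s)) + ∫⁻ s, e s * κ (t - s)) := by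
        rw [lintegral_add_left (by fun_prop)]
      _ ≤ A + (A + ∫⁻ s, e s * κ (t - s)) := by gcongr; exact const_le t
      _ = 2 * A + ∫⁻ s, e s * κ (t - s) := by rw [two_mul, add_assoc]
  have he_fin : ∫⁻ t, e t ≠ ⊤ :=
    ne_top_of_le_ne_top hg_fin (lintegral_mono fun _ ↦ tsub_le_self)
  have he_half : ∫⁻ t, e t ≤ (∫⁻ t, e t) * 2⁻¹ :=
    calc ∫⁻ t, e t ≤ ∫⁻ t, ∫⁻ s, e s * κ (t - s) := lintegral_mono he_le
      _ = ∫⁻ s, ∫⁻ t, e s * κ (t - s) := by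
        refine lintegral_lintegral_swap ?_
        exact (he_meas.comp_snd).mul
          (hκ.comp (measurable_fst.sub measurable_snd)).aemeasurable
      _ = ∫⁻ s, e s * ∫⁻ x, κ x := by
        refine lintegral_congr fun s ↦ ?_
        rw [lintegral_const_mul _ (by fun_prop), lintegral_sub_right_eq_self κ s]
      _ = (∫⁻ s, e s) * ∫⁻ x, κ x := lintegral_mul_const'' _ he_meas
      _ ≤ (∫⁻ s, e s) * 2⁻¹ := by gcongr
  have he_zero : ∫⁻ t, e t = 0 := by
    by_contra hne
    rw [← div_eq_mul_inv] at he_half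
    exact (ENNReal.half_lt_self hne he_fin).not_ge he_half
  have hg_le : ∀ᵐ s, g s ≤ 2 * A := by
    filter_upwards [(lintegral_eq_zero_iff' he_meas).1 he_zero] with s hs
    exact tsub_eq_zero_iff_le.1 hs
  have hg_le' : ∫⁻ s, g s * κ (t - s) ≤ ∫⁻ s, 2 * A * κ (t - s) := by
    refine lintegral_mono_ae ?_
    filter_upwards [hg_le] with s hs
    gcongr
  calc g t ≤ A + ∫⁻ s, g s * κ (t - s) := h t
    _ ≤ A + A := by gcongr; exact hg_le'.trans (const_le t)
    _ = 2 * A := (two_mul A).symm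

/-- With a large enough exponential rate, the damped singular kernel has mass at most `1 / 2`. -/
theorem exists_lintegral_damped_rpow_le_half {α b : ℝ} (hα : 0 < α) (hb : 0 ≤ b) :
    ∃ r : ℝ, 0 < r ∧
      ∫⁻ x in Ioi (0 : ℝ), ENNReal.ofReal (b * (x ^ (α - 1) * Real.exp (-(r * x)))) ≤ 2⁻¹ := by
  have hΓ := Real.Gamma_pos_of_pos hα
  set C : ℝ := 2 * (b * Real.Gamma α) + 1 with hC
  have hC_pos : 0 < C := by positivity
  have hr : 0 < C ^ α⁻¹ := by positivity
  have hpow : (1 / C ^ α⁻¹) ^ α = C⁻¹ := by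
    rw [one_div, Real.inv_rpow hr.le, Real.rpow_inv_rpow hC_pos.le hα.ne']
  have hval := Real.integral_rpow_mul_exp_neg_mul_Ioi hα hr
  rw [hpow] at hval
  have hint : IntegrableOn (fun x : ℝ ↦ x ^ (α - 1) * Real.exp (-(C ^ α⁻¹ * x))) (Ioi 0) := by
    refine Integrable.of_integral_ne_zero ?_
    rw [hval]
    positivity
  refine ⟨C ^ α⁻¹, hr, ?_⟩
  rw [← ofReal_integral_eq_lintegral_ofReal (hint.const_mul b), integral_const_mul, hval]
  · rw [show (2⁻¹ : ENNReal) = ENNReal.ofReal 2⁻¹ by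
      rw [ENNReal.ofReal_inv_of_pos two_pos, ENNReal.ofReal_ofNat]]
    refine ENNReal.ofReal_le_ofReal ?_
    rw [show b * (C⁻¹ * Real.Gamma α) = b * Real.Gamma α / C by ring, div_le_iff₀ hC_pos]
    linarith
  · filter_upwards [ae_restrict_mem measurableSet_Ioi] with x hx
    have : 0 < x := hx
    simp only [Pi.zero_apply]
    positivity

/-- Extended Gronwall lemma with weakly singular kernel. -/
theorem extended_gronwall_singular_kernel
    (α b T : ℝ) (hα : 0 < α) (hb : 0 ≤ b) (hT : 0 ≤ T) :
    ∃ K : ℝ, ∀ (a : ℝ) (u : ℝ → ℝ), 0 ≤ a →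
      (∀ t ∈ Icc (0:ℝ) T, 0 ≤ u t) →
      IntegrableOn u (Icc (0:ℝ) T) →
      (∀ t ∈ Icc (0:ℝ) T,
        u t ≤ a + b * ∫ s in Ioo (0:ℝ) t, u s * (t - s) ^ (α - 1)) →
      ∀ t ∈ Icc (0:ℝ) T, u t ≤ a * K := by
  obtain ⟨r, hr, hκ_le⟩ := exists_lintegral_damped_rpow_le_half hα hb
  refine ⟨2 * Real.exp (r * T), fun a u ha hu hu_int h t ht ↦ ?_⟩
  set κ : ℝ → ENNReal := (Ioi (0 : ℝ)).indicator
    fun x ↦ ENNReal.ofReal (b * (x ^ (α - 1) * Real.exp (-(r * x)))) with hκ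
  set g : ℝ → ENNReal := (Icc (0 : ℝ) T).indicator
    fun t ↦ ENNReal.ofReal (Real.exp (-(r * t)) * u t) with hg
  have hint : IntegrableOn (fun t ↦ Real.exp (-(r * t)) * u t) (Icc 0 T) :=
    hu_int.continuousOn_mul (by fun_prop) isCompact_Icc
  have hg_meas : AEMeasurable g :=
    (aemeasurable_indicator_iff measurableSet_Icc).2 hint.aemeasurable.ennreal_ofReal
  have hg_fin : ∫⁻ t, g t ≠ ⊤ := by
    rw [hg, lintegral_indicator measurableSet_Icc]
    exact hint.lintegral_lt_top.ne
  have hκ_meas : Measurable κ := Measurable.indicator (by fun_prop) measurableSet_Ioi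
  have hκ_half : ∫⁻ x, κ x ≤ 2⁻¹ := by
    rwa [hκ, lintegral_indicator measurableSet_Ioi]
  have hg_le (t : ℝ) : g t ≤ ENNReal.ofReal a + ∫⁻ s, g s * κ (t - s) := by
    by_cases ht : t ∈ Icc 0 T
    swap
    · simp [hg, indicator_of_notMem ht]
    have hexp : Real.exp (-(r * t)) ≤ 1 :=
      Real.exp_le_one_iff.2 (neg_nonpos.2 (mul_nonneg hr.le ht.1))
    have hkernel : ∀ s ∈ Ioo 0 t,
        ‖Real.exp (-(r * t)) * b * (u s * (t - s) ^ (α - 1))‖ₑ = g s * κ (t - s) := by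
      intro s hs
      have hsT : s ∈ Icc 0 T := ⟨hs.1.le, hs.2.le.trans ht.2⟩
      have hts : 0 < t - s := sub_pos.2 hs.2
      have hus := hu s hsT
      rw [hg, hκ, indicator_of_mem hsT, indicator_of_mem (mem_Ioi.2 hts),
        ← ENNReal.ofReal_mul (by positivity), Real.enorm_eq_ofReal (by positivity),
        show -(r * t) = -(r * s) + -(r * (t - s)) by ring, Real.exp_add]
      congr 1
      ring
    calc g t = ENNReal.ofReal (Real.exp (-(r * t)) * u t) := indicator_of_mem ht _
      _ ≤ ENNReal.ofReal
          (a + ∫ s in Ioo 0 t, Real.exp (-(r * t)) * b * (u s * (t - s) ^ (α - 1))) := by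
        refine ENNReal.ofReal_le_ofReal ?_
        rw [integral_const_mul]
        calc Real.exp (-(r * t)) * u t
            ≤ Real.exp (-(r * t)) * (a + b * ∫ s in Ioo 0 t, u s * (t - s) ^ (α - 1)) := by
              gcongr
              exact h t ht
          _ = Real.exp (-(r * t)) * a +
              Real.exp (-(r * t)) * b * ∫ s in Ioo 0 t, u s * (t - s) ^ (α - 1) := by ring
          _ ≤ _ := by
              gcongr
              exact mul_le_of_le_one_left ha hexp
      _ ≤ ENNReal.ofReal a + ENNReal.ofReal
          (∫ s in Ioo 0 t, Real.exp (-(r * t)) * b * (u s * (t - s) ^ (α - 1))) :=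
        ENNReal.ofReal_add_le
      _ ≤ ENNReal.ofReal a + ∫⁻ s, g s * κ (t - s) := by
        gcongr
        refine (Real.ofReal_le_enorm _).trans ((enorm_integral_le_lintegral_enorm _).trans ?_)
        rw [setLIntegral_congr_fun measurableSet_Ioo hkernel]
        exact setLIntegral_le_lintegral _ _
  have hgt := le_two_mul_of_le_add_lintegral_mul_kernel hg_meas hg_fin hκ_meas hκ_half hg_le t
  rw [hg, indicator_of_mem ht, ← ENNReal.ofReal_ofNat 2, ← ENNReal.ofReal_mul two_pos.le,
    ENNReal.ofReal_le_ofReal_iff (by positivity)] at hgt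
  calc u t = Real.exp (r * t) * (Real.exp (-(r * t)) * u t) := by
        rw [← mul_assoc, ← Real.exp_add, add_neg_cancel, Real.exp_zero, one_mul]
    _ ≤ Real.exp (r * T) * (2 * a) := by
        have hut := hu t ht
        gcongr
        exact ht.2
    _ = a * (2 * Real.exp (r * T)) := by ring
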